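/- Let k be a field and A an associative k-algebra, and regard A as a module over its enveloping algebra A^e = A ⊗_k A^{op} (equivalently, as an A-bimodule via left and right multiplication). Then the Hochschild cohomology algebra HH^*(A) = Ext^*_{A^e}(A, A) = ⊕_{p ≥ 0} Ext^p_{A^e}(A, A) is graded-commutative under the Yoneda product: for every f ∈ Ext^p_{A^e}(A, A) and g ∈ Ext^q_{A^e}(A, A), one has g ∘ f = (−1)^{pq} f ∘ g in Ext^{p+q}_{A^e}(A, A). -/

import Mathlib

open CategoryTheory CategoryTheory.Abelian TensorProduct

universe u

namespace CategoryTheory.ShortComplex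

open Limits

universe w v' u'

variable {C : Type u'} [Category.{v'} C] [Abelian C]

/-- In a three by three diagram with exact rows and columns, the two composites of connecting
classes from the last corner to the first one are opposite to each other. -/
theorem extClass_comp_extClass_eq_neg [HasExt.{w} C] {R₁ R₂ R₃ : ShortComplex C}
    {f : R₁ ⟶ R₂} {g : R₂ ⟶ R₃}
    {z₁ : f.τ₁ ≫ g.τ₁ = 0} {z₂ : f.τ₂ ≫ g.τ₂ = 0} {z₃ : f.τ₃ ≫ g.τ₃ = 0}
    (h₁ : R₁.ShortExact) (h₂ : R₂.ShortExact) (h₃ : R₃.ShortExact)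
    (c₁ : (ShortComplex.mk f.τ₁ g.τ₁ z₁).ShortExact)
    (c₂ : (ShortComplex.mk f.τ₂ g.τ₂ z₂).ShortExact)
    (c₃ : (ShortComplex.mk f.τ₃ g.τ₃ z₃).ShortExact) :
    h₃.extClass.comp c₁.extClass (rfl : 1 + 1 = 2) =
      -c₃.extClass.comp h₁.extClass (rfl : 1 + 1 = 2) := by
  have := h₁.mono_f
  have := h₂.mono_f
  have := h₂.epi_g
  have := h₃.mono_f
  have : Epi g.τ₁ := c₁.epi_g
  have : Mono f.τ₂ := c₂.mono_f
  have : Mono f.τ₃ := c₃.mono_f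
  have : Epi g.τ₃ := c₃.epi_g
  let d : R₂.X₂ ⟶ R₃.X₃ := R₂.g ≫ g.τ₃
  have hd : kernel.ι d ≫ R₂.g ≫ g.τ₃ = 0 := kernel.condition d
  have hV : (ShortComplex.mk (kernel.ι d) d (kernel.condition d)).ShortExact :=
    { exact := exact_kernel d
      mono_f := inferInstanceAs (Mono (kernel.ι d))
      epi_g := inferInstanceAs (Epi (R₂.g ≫ g.τ₃)) }
  obtain ⟨s, hs⟩ : ∃ s : R₁.X₂ ⊞ R₂.X₁ ⟶ kernel d, s ≫ kernel.ι d = biprod.desc f.τ₂ R₂.f :=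
    ⟨kernel.lift d (biprod.desc f.τ₂ R₂.f) (by ext <;> simp [d, f.comm₂₃_assoc, z₃]), by simp⟩
  have zs : biprod.lift R₁.f (-f.τ₁) ≫ s = 0 := by
    rw [← cancel_mono (kernel.ι d), Category.assoc, hs]
    simp [biprod.lift_desc, f.comm₁₂]
  have hW : (ShortComplex.mk _ _ zs).ShortExact :=
    { exact := by
        rw [exact_iff_exact_up_to_refinements]
        dsimp only
        intro Z x hx
        have hx' : (x ≫ biprod.fst) ≫ f.τ₂ + (x ≫ biprod.snd) ≫ R₂.f = 0 := by
          have hxs := hx =≫ kernel.ι d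
          rw [Category.assoc, hs, biprod.desc_eq] at hxs
          simpa using hxs
        have hx₁ : (x ≫ biprod.fst) ≫ R₁.g = 0 := by
          rw [← cancel_mono f.τ₃, Category.assoc, ← f.comm₂₃, ← Category.assoc,
            eq_neg_of_add_eq_zero_left hx']
          simp
        refine ⟨Z, 𝟙 Z, inferInstance, h₁.exact.lift _ hx₁, ?_⟩
        rw [Category.id_comp]
        apply biprod.hom_ext
        · simp
        · rw [← cancel_mono R₂.f, eq_neg_of_add_eq_zero_right hx']
          simp [f.comm₁₂]
      mono_f := by
        have : Mono (biprod.lift R₁.f (-f.τ₁) ≫ biprod.fst) := by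
          rw [biprod.lift_fst]
          infer_instance
        exact mono_of_mono _ biprod.fst
      epi_g := by
        rw [epi_iff_surjective_up_to_refinements]
        dsimp only
        intro Z y
        have hy : (y ≫ kernel.ι d ≫ g.τ₂) ≫ R₃.g = 0 := by
          simp [g.comm₂₃, hd]
        obtain ⟨Z', π, _, a, ha⟩ :=
          surjective_up_to_refinements_of_epi g.τ₁ (h₃.exact.lift _ hy)
        have hb : (π ≫ y ≫ kernel.ι d - a ≫ R₂.f) ≫ g.τ₂ = 0 := by
          simp [← g.comm₁₂, ← reassoc_of% ha]
        obtain ⟨b, hb⟩ : ∃ b, b ≫ f.τ₂ = π ≫ y ≫ kernel.ι d - a ≫ R₂.f :=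
          ⟨c₂.exact.lift _ hb, c₂.exact.lift_f _ hb⟩
        refine ⟨Z', π, inferInstance, biprod.lift b a, ?_⟩
        rw [← cancel_mono (kernel.ι d), Category.assoc, Category.assoc, hs, biprod.lift_desc, hb]
        simp }
  obtain ⟨φ, hφ⟩ : ∃ φ, φ ≫ R₃.f = kernel.ι d ≫ g.τ₂ :=
    ⟨h₃.exact.lift (kernel.ι d ≫ g.τ₂) (by simp [g.comm₂₃, hd]), h₃.exact.lift_f _ _⟩
  obtain ⟨ψ, hψ⟩ : ∃ ψ, ψ ≫ f.τ₃ = kernel.ι d ≫ R₂.g :=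
    ⟨c₃.exact.lift (kernel.ι d ≫ R₂.g) (by simp [hd]), c₃.exact.lift_f _ _⟩
  have eφ := ShortExact.extClass_naturality hV h₃
    { τ₁ := φ, τ₂ := g.τ₂, τ₃ := 𝟙 _, comm₂₃ := by simp [d, g.comm₂₃] }
  have eψ := ShortExact.extClass_naturality hV c₃
    { τ₁ := ψ, τ₂ := R₂.g, τ₃ := 𝟙 _, comm₂₃ := by simp [d] }
  have eχ := ShortExact.extClass_naturality hW h₁
    { τ₁ := 𝟙 _, τ₂ := biprod.fst, τ₃ := ψ, comm₂₃ := by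
        rw [← cancel_mono f.τ₃, Category.assoc, Category.assoc, hψ, reassoc_of% hs]
        ext <;> simp [f.comm₂₃] }
  have eω := ShortExact.extClass_naturality hW c₁
    { τ₁ := -𝟙 _, τ₂ := biprod.snd, τ₃ := φ, comm₁₂ := by simp, comm₂₃ := by
        rw [← cancel_mono R₃.f, Category.assoc, Category.assoc, hφ, reassoc_of% hs]
        ext <;> simp [z₂, g.comm₁₂] }
  simp only [Ext.mk₀_id_comp, Ext.comp_mk₀_id, Ext.mk₀_neg, Ext.comp_neg] at eφ eψ eχ eω
  rw [← eφ, ← eψ, Ext.comp_assoc (a₂₃ := 1) _ _ _ _ (zero_add 1) (by omega), ← eω,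
    Ext.comp_assoc (a₂₃ := 1) _ _ _ _ (zero_add 1) (by omega), ← eχ, Ext.comp_neg]

end CategoryTheory.ShortComplex

namespace CategoryTheory.Abelian.Ext

open Limits

universe w w' v₁ v₂ u₁ u₂

variable {C : Type u₁} [Category.{v₁} C] [Abelian C] [HasExt.{w} C]
  {D : Type u₂} [Category.{v₂} D] [Abelian D] [HasExt.{w'} D]

theorem comp_zsmul {X Y Z : C} {a b c : ℕ} (α : Ext X Y a) (n : ℤ) (β : Ext Y Z b)
    (h : a + b = c) : α.comp (n • β) h = n • α.comp β h :=
  map_zsmul ((bilinearComp X Y Z a b c h) α) n β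

theorem zsmul_comp {X Y Z : C} {a b c : ℕ} (n : ℤ) (α : Ext X Y a) (β : Ext Y Z b)
    (h : a + b = c) : (n • α).comp β h = n • α.comp β h :=
  map_zsmul ((bilinearComp X Y Z a b c h).flip β) n α

/-- An Ext class of positive degree out of `M` factors through the connecting class of any
short exact sequence with last term `M` and projective middle term. -/
theorem exists_eq_extClass_comp [EnoughProjectives C] {M N : C} {n : ℕ} (g : Ext M N (n + 1)) :
    ∃ (K P : C) (i : K ⟶ P) (π : P ⟶ M) (z : i ≫ π = 0) (hS : (ShortComplex.mk i π z).ShortExact)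
      (_ : Projective P) (g' : Ext K N n), g = hS.extClass.comp g' (add_comm 1 n) := by
  let S := ShortComplex.mk (kernel.ι (Projective.π M)) (Projective.π M) (kernel.condition _)
  have hS : S.ShortExact :=
    { exact := ShortComplex.exact_kernel (Projective.π M)
      mono_f := inferInstanceAs (Mono (kernel.ι (Projective.π M)))
      epi_g := inferInstanceAs (Epi (Projective.π M)) }
  obtain ⟨g', hg'⟩ := contravariant_sequence_exact₃ hS N g (eq_zero_of_projective _)
    (add_comm 1 n)
  exact ⟨_, _, _, _, _, hS, inferInstance, g', hg'.symm⟩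

section

variable [EnoughProjectives C] {F G : C ⥤ D} [F.Additive] [PreservesFiniteLimits F]
  [PreservesFiniteColimits F] [G.Additive] [PreservesFiniteLimits G] [PreservesFiniteColimits G]

theorem mk₀_app_comp_mapExactFunctor (η : F ⟶ G) {q : ℕ} {M N : C} (g : Ext M N q) :
    (mk₀ (η.app M)).comp (g.mapExactFunctor G) (zero_add q) =
      (g.mapExactFunctor F).comp (mk₀ (η.app N)) (add_zero q) := by
  induction q generalizing M with
  | zero =>
    obtain ⟨g, rfl⟩ := (mk₀_bijective M N).2 g
    simp [mapExactFunctor_mk₀]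
  | succ q ih =>
    obtain ⟨K, P, i, π, z, hS, _, g', rfl⟩ := exists_eq_extClass_comp g
    have hF : (ShortComplex.mk (F.map i) (F.map π) (by simp [← F.map_comp, z])).ShortExact :=
      hS.map_of_exact F
    have hG : (ShortComplex.mk (G.map i) (G.map π) (by simp [← G.map_comp, z])).ShortExact :=
      hS.map_of_exact G
    have eF : hS.extClass.mapExactFunctor F = hF.extClass := mapExactFunctor_extClass F hS
    have eG : hS.extClass.mapExactFunctor G = hG.extClass := mapExactFunctor_extClass G hS
    have h : hF.extClass.comp (mk₀ (η.app K)) (add_zero 1) =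
        (mk₀ (η.app M)).comp hG.extClass (zero_add 1) :=
      ShortComplex.ShortExact.extClass_naturality hF hG
        { τ₁ := η.app K, τ₂ := η.app P, τ₃ := η.app M
          comm₁₂ := (η.naturality i).symm, comm₂₃ := (η.naturality π).symm }
    rw [mapExactFunctor_comp, mapExactFunctor_comp, eF, eG, comp_assoc_of_third_deg_zero, ← ih,
      ← comp_assoc _ _ _ (zero_add 1) (add_comm 1 q) (by lia), ← h, comp_assoc_of_second_deg_zero]

variable {H : C ⥤ D} [H.Additive] [PreservesFiniteLimits H] [PreservesFiniteColimits H]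

theorem extClass_comp_mapExactFunctor (α : F ⟶ G) (β : G ⟶ H)
    (z : ∀ X, α.app X ≫ β.app X = 0) (h : ∀ X, (ShortComplex.mk _ _ (z X)).ShortExact)
    {q : ℕ} {M N : C} (g : Ext M N q) :
    (h M).extClass.comp (g.mapExactFunctor F) (add_comm 1 q) =
      (-1 : ℤ) ^ q • (g.mapExactFunctor H).comp (h N).extClass rfl := by
  induction q generalizing M with
  | zero =>
    obtain ⟨g, rfl⟩ := (mk₀_bijective M N).2 g
    have := ShortComplex.ShortExact.extClass_naturality (h M) (h N)
      { τ₁ := F.map g, τ₂ := G.map g, τ₃ := H.map g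
        comm₁₂ := α.naturality g, comm₂₃ := β.naturality g }
    simpa [mapExactFunctor_mk₀] using this
  | succ q ih =>
    obtain ⟨K, P, i, π, w, hS, _, g', rfl⟩ := exists_eq_extClass_comp g
    have hF : (ShortComplex.mk (F.map i) (F.map π) (by simp [← F.map_comp, w])).ShortExact :=
      hS.map_of_exact F
    have hG : (ShortComplex.mk (G.map i) (G.map π) (by simp [← G.map_comp, w])).ShortExact :=
      hS.map_of_exact G
    have hH : (ShortComplex.mk (H.map i) (H.map π) (by simp [← H.map_comp, w])).ShortExact :=
      hS.map_of_exact H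
    have eF : hS.extClass.mapExactFunctor F = hF.extClass := mapExactFunctor_extClass F hS
    have eH : hS.extClass.mapExactFunctor H = hH.extClass := mapExactFunctor_extClass H hS
    have h' : (h M).extClass.comp hF.extClass (rfl : 1 + 1 = 2) =
        -hH.extClass.comp (h K).extClass (rfl : 1 + 1 = 2) :=
      neg_eq_iff_eq_neg.1 (ShortComplex.extClass_comp_extClass_eq_neg
        (R₁ := .mk (F.map i) (F.map π) (by simp [← F.map_comp, w]))
        (R₂ := .mk (G.map i) (G.map π) (by simp [← G.map_comp, w]))
        (R₃ := .mk (H.map i) (H.map π) (by simp [← H.map_comp, w]))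
        (f := { τ₁ := α.app K, τ₂ := α.app P, τ₃ := α.app M
                comm₁₂ := (α.naturality i).symm, comm₂₃ := (α.naturality π).symm })
        (g := { τ₁ := β.app K, τ₂ := β.app P, τ₃ := β.app M
                comm₁₂ := (β.naturality i).symm, comm₂₃ := (β.naturality π).symm })
        hF hG hH (h K) (h P) (h M)).symm
    rw [mapExactFunctor_comp, mapExactFunctor_comp, eF, eH,
      ← comp_assoc _ _ _ (rfl : 1 + 1 = 2) (add_comm 1 q) (by lia), h', neg_comp,
      comp_assoc _ _ _ (rfl : 1 + 1 = 2) (add_comm 1 q) (by lia), ih,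
      comp_assoc _ _ _ (add_comm 1 q) rfl (by lia), comp_zsmul, pow_succ, mul_neg_one, neg_smul]

end

theorem mapExactFunctor_id [EnoughProjectives C] {q : ℕ} {M N : C} (g : Ext M N q) :
    g.mapExactFunctor (𝟭 C) = g := by
  induction q generalizing M with
  | zero =>
    obtain ⟨g, rfl⟩ := (mk₀_bijective M N).2 g
    exact mapExactFunctor_mk₀ _ _
  | succ q ih =>
    obtain ⟨K, P, i, π, z, hS, _, g', rfl⟩ := exists_eq_extClass_comp g
    have e : hS.extClass.mapExactFunctor (𝟭 C) = hS.extClass := mapExactFunctor_extClass (𝟭 C) hS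
    rw [mapExactFunctor_comp, e, ih]

end CategoryTheory.Abelian.Ext

open CategoryTheory Limits in
/-- A bifunctor on an abelian category with a two-sided unit object, together with a class of
flat objects, containing the projective ones, that can be used to resolve the first variable. -/
structure UnitalBifunctor (C : Type*) [Category* C] [Abelian C] where
  tensor : C ⥤ C ⥤ C
  unit : C
  flat : ObjectProperty C
  additive (X : C) : (tensor.obj X).Additive
  flat_of_projective (X : C) : Projective X → flat X
  flat_unit : flat unit
  flat_left {S : ShortComplex C} : S.ShortExact → flat S.X₂ → flat S.X₃ → flat S.X₁
  preservesFiniteLimits {X : C} : flat X → PreservesFiniteLimits (tensor.obj X)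
  preservesFiniteColimits {X : C} : flat X → PreservesFiniteColimits (tensor.obj X)
  shortExact_app {X₁ X₂ X₃ : C} (i : X₁ ⟶ X₂) (π : X₂ ⟶ X₃) (z : i ≫ π = 0) :
    (ShortComplex.mk i π z).ShortExact → flat X₃ → ∀ M,
      ∃ z' : (tensor.map i).app M ≫ (tensor.map π).app M = 0, (ShortComplex.mk _ _ z').ShortExact
  left (M : C) : (tensor.obj unit).obj M ⟶ M
  right (X : C) : (tensor.obj X).obj unit ⟶ X
  left_naturality {M N : C} (φ : M ⟶ N) : (tensor.obj unit).map φ ≫ left N = left M ≫ φ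
  right_naturality {X Y : C} (φ : X ⟶ Y) : (tensor.map φ).app unit ≫ right Y = right X ≫ φ
  left_unit : left unit = right unit
  isIso_left_unit : IsIso (left unit)

namespace UnitalBifunctor

open CategoryTheory Limits Abelian Ext

variable {C : Type*} [Category* C] [Abelian C] [HasExt C] [EnoughProjectives C]
  (T : UnitalBifunctor C)

attribute [instance] UnitalBifunctor.additive

theorem left_comp [PreservesFiniteLimits (T.tensor.obj T.unit)]
    [PreservesFiniteColimits (T.tensor.obj T.unit)] {q : ℕ} {M N : C} (g : Ext M N q) :
    (mk₀ (T.left M)).comp g (zero_add q) =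
      (g.mapExactFunctor (T.tensor.obj T.unit)).comp (mk₀ (T.left N)) (add_zero q) := by
  conv_lhs => rw [← mapExactFunctor_id g]
  exact mk₀_app_comp_mapExactFunctor (F := T.tensor.obj T.unit) (G := 𝟭 C)
    { app := T.left, naturality := fun _ _ φ => T.left_naturality φ } g

theorem right_comp_comp {X : C} (hX : T.flat X) [PreservesFiniteLimits (T.tensor.obj X)]
    [PreservesFiniteColimits (T.tensor.obj X)] {p q : ℕ} (f : Ext X T.unit p)
    (g : Ext T.unit T.unit q) :
    (mk₀ (T.right X)).comp (f.comp g rfl) (zero_add _) =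
      (-1 : ℤ) ^ (p * q) • (g.mapExactFunctor (T.tensor.obj X)).comp
        ((mk₀ (T.right X)).comp f (zero_add p)) (add_comm q p) := by
  induction p generalizing X with
  | zero =>
    obtain ⟨φ, rfl⟩ := (mk₀_bijective X T.unit).2 f
    have := T.preservesFiniteLimits T.flat_unit
    have := T.preservesFiniteColimits T.flat_unit
    have h := mk₀_app_comp_mapExactFunctor (T.tensor.map φ) g
    have h' : (mk₀ (T.right X)).comp (mk₀ φ) (add_zero 0) =
        (mk₀ ((T.tensor.map φ).app T.unit)).comp (mk₀ (T.left T.unit)) (add_zero 0) := by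
      rw [mk₀_comp_mk₀, mk₀_comp_mk₀, T.left_unit, T.right_naturality]
    rw [zero_mul, pow_zero, one_smul, h', ← comp_assoc _ _ _ (add_zero 0) rfl (by lia), h',
      comp_assoc_of_second_deg_zero, T.left_comp, ← comp_assoc _ _ _ (zero_add q) _ (by lia), h,
      comp_assoc_of_second_deg_zero]
  | succ p ih =>
    obtain ⟨K, Q, i, π, z, hS, hQ, f', rfl⟩ := exists_eq_extClass_comp f
    have hQ := T.flat_of_projective Q hQ
    have hK : T.flat K := T.flat_left hS hQ hX
    have := T.preservesFiniteLimits hK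
    have := T.preservesFiniteColimits hK
    have := T.preservesFiniteLimits hQ
    have := T.preservesFiniteColimits hQ
    choose z' h using T.shortExact_app i π z hS hX
    have h₁ : (h T.unit).extClass.comp (mk₀ (T.right K)) (add_zero 1) =
        (mk₀ (T.right X)).comp hS.extClass (zero_add 1) :=
      ShortComplex.ShortExact.extClass_naturality (h T.unit) hS
        { τ₁ := T.right K, τ₂ := T.right Q, τ₃ := T.right X
          comm₁₂ := (T.right_naturality i).symm, comm₂₃ := (T.right_naturality π).symm }
    have h₂ := extClass_comp_mapExactFunctor (T.tensor.map i) (T.tensor.map π) z' h g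
    calc
      _ = (h T.unit).extClass.comp ((mk₀ (T.right K)).comp (f'.comp g rfl) (zero_add _))
          (by lia) := by
        rw [comp_assoc _ _ _ _ rfl (by lia), ← comp_assoc _ _ _ (zero_add 1) (by lia) (by lia), ← h₁,
          comp_assoc_of_second_deg_zero]
      _ = (-1 : ℤ) ^ (p * q) • ((h T.unit).extClass.comp (g.mapExactFunctor (T.tensor.obj K))
          (add_comm 1 q)).comp ((mk₀ (T.right K)).comp f' (zero_add p)) (by lia) := by
        rw [ih hK, comp_zsmul, comp_assoc _ _ _ _ _ (by lia)]
      _ = _ := by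
        rw [h₂, zsmul_comp, smul_smul, comp_assoc _ _ _ _ (add_comm 1 p) (by lia),
          ← comp_assoc _ _ _ (add_zero 1) _ (by lia), h₁, ← pow_add, add_one_mul,
          comp_assoc _ _ _ _ _ (by lia)]

/-- An Eckmann-Hilton argument for the self-extensions of the unit object. -/
theorem comp_eq_neg_one_pow_smul_comp {p q : ℕ} (f : Ext T.unit T.unit p)
    (g : Ext T.unit T.unit q) :
    f.comp g rfl = (-1 : ℤ) ^ (p * q) • g.comp f (add_comm q p) := by
  have := T.preservesFiniteLimits T.flat_unit
  have := T.preservesFiniteColimits T.flat_unit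
  have := T.isIso_left_unit
  have h := T.right_comp_comp T.flat_unit f g
  rw [← T.left_unit, ← comp_assoc _ _ _ (add_zero q) _ (by lia), ← T.left_comp,
    comp_assoc _ _ _ _ (add_comm q p) (by lia), ← comp_zsmul] at h
  have cancel {n : ℕ} (x : Ext T.unit T.unit n) : x = (mk₀ (inv (T.left T.unit))).comp
      ((mk₀ (T.left T.unit)).comp x (zero_add n)) (zero_add n) := by
    rw [← comp_assoc_of_second_deg_zero, mk₀_comp_mk₀, IsIso.inv_hom_id, mk₀_id_comp]
  rw [cancel (f.comp g rfl), h, ← cancel]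

end UnitalBifunctor

section

open MulOpposite
open scoped ModuleCat

variable {k : Type u} [Field k] {A : Type u} [Ring A] [Algebra k A]

/-- The subgroup of `X ⊗[k] M` by which one has to divide in order to make the right action of `A`
on `X` agree with the left action of `A` on `M`. -/
def balancing (X M : ModuleCat.{u} (A ⊗[k] Aᵐᵒᵖ)) : AddSubgroup (X ⊗[k] M) :=
  AddSubgroup.closure {t | ∃ (a : A) (x : X) (m : M),
    t = ((1 ⊗ₜ op a : A ⊗[k] Aᵐᵒᵖ) • x) ⊗ₜ m - x ⊗ₜ ((a ⊗ₜ 1 : A ⊗[k] Aᵐᵒᵖ) • m)}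

/-- The tensor product `X ⊗_A M` of two `A`-bimodules, seen as modules over the enveloping algebra
of `A`. -/
def BimoduleTensor (X M : ModuleCat.{u} (A ⊗[k] Aᵐᵒᵖ)) : Type u :=
  (X ⊗[k] M) ⧸ balancing X M

theorem Module.Projective.restrictScalars {R S : Type u} [Ring R] [Ring S] (ρ : R →+* S)
    (hS : Module.Projective R ((ModuleCat.restrictScalars ρ).obj (ModuleCat.of S S)))
    (X : ModuleCat.{u} S) [hX : Module.Projective S X] :
    Module.Projective R ((ModuleCat.restrictScalars ρ).obj X) := by
  obtain ⟨s, hs⟩ := Module.projective_def'.1 hX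
  let F := X →₀ ((ModuleCat.restrictScalars ρ).obj (ModuleCat.of S S))
  have : Module.Projective R F := by
    classical exact Module.Projective.of_equiv (finsuppLequivDFinsupp R).symm
  let i : (ModuleCat.restrictScalars ρ).obj X →ₗ[R] F :=
    { toFun := s
      map_add' := s.map_add
      map_smul' b x := s.map_smul (ρ b) x }
  let r : F →ₗ[R] (ModuleCat.restrictScalars ρ).obj X :=
    { toFun := Finsupp.linearCombination S (id : X → X)
      map_add' := (Finsupp.linearCombination S (id : X → X)).map_add
      map_smul' b x := (Finsupp.linearCombination S (id : X → X)).map_smul (ρ b) x }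
  exact Module.Projective.of_split i r (LinearMap.ext fun x => LinearMap.congr_fun hs x)

namespace BimoduleTensor

variable {X X' M M' : ModuleCat.{u} (A ⊗[k] Aᵐᵒᵖ)}

noncomputable instance : AddCommGroup (BimoduleTensor X M) :=
  inferInstanceAs (AddCommGroup ((X ⊗[k] M) ⧸ balancing X M))

variable (X M) in
/-- The universal balanced biadditive map. -/
noncomputable def mk : X →+ M →+ BimoduleTensor X M :=
  AddMonoidHom.mk' (fun x => AddMonoidHom.mk'
      (fun m => QuotientAddGroup.mk' (balancing X M) (x ⊗ₜ m))
      fun m m' => (congrArg _ (tmul_add x m m')).trans (map_add _ _ _))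
    fun x x' => by ext m; exact (congrArg (QuotientAddGroup.mk' (balancing X M))
      (add_tmul x x' m)).trans (map_add (QuotientAddGroup.mk' (balancing X M)) _ _)

theorem mk_smul (a : A) (x : X) (m : M) :
    mk X M ((1 ⊗ₜ op a : A ⊗[k] Aᵐᵒᵖ) • x) m = mk X M x ((a ⊗ₜ 1 : A ⊗[k] Aᵐᵒᵖ) • m) :=
  (QuotientAddGroup.eq_iff_sub_mem (N := balancing X M)).2
    (AddSubgroup.subset_closure ⟨a, x, m, rfl⟩)

@[elab_as_elim]
theorem induction {motive : BimoduleTensor X M → Prop} (t : BimoduleTensor X M)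
    (zero : motive 0) (mk : ∀ x m, motive (mk X M x m))
    (add : ∀ s t, motive s → motive t → motive (s + t)) : motive t := by
  obtain ⟨t, rfl⟩ := QuotientAddGroup.mk'_surjective (balancing X M) t
  induction t with
  | zero => exact zero
  | tmul x m => exact mk x m
  | add s t hs ht => exact add _ _ hs ht

theorem hom_ext {V : Type*} [AddCommGroup V] {f g : BimoduleTensor X M →+ V}
    (h : ∀ x m, f (mk X M x m) = g (mk X M x m)) : f = g := by
  ext t
  induction t using induction with
  | zero => simp
  | mk x m => exact h x m
  | add s t hs ht => simp [hs, ht]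

/-- The additive map induced by a balanced biadditive map. -/
noncomputable def lift {V : Type*} [AddCommGroup V] (f : X →+ M →+ V)
    (hf : ∀ (a : A) x m, f ((1 ⊗ₜ op a : A ⊗[k] Aᵐᵒᵖ) • x) m =
      f x ((a ⊗ₜ 1 : A ⊗[k] Aᵐᵒᵖ) • m)) : BimoduleTensor X M →+ V :=
  QuotientAddGroup.lift (balancing X M)
    (TensorProduct.liftAddHom f fun c x m => by
      have h := hf (algebraMap k A c) x m
      rwa [← MulOpposite.algebraMap_apply, ← Algebra.TensorProduct.algebraMap_apply',
        ← Algebra.TensorProduct.algebraMap_apply, algebraMap_smul, algebraMap_smul] at h)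
    ((AddSubgroup.closure_le _).2 (by
      rintro _ ⟨a, x, m, rfl⟩
      simp [hf]))

@[simp]
theorem lift_mk {V : Type*} [AddCommGroup V] (f : X →+ M →+ V)
    (hf : ∀ (a : A) x m, f ((1 ⊗ₜ op a : A ⊗[k] Aᵐᵒᵖ) • x) m =
      f x ((a ⊗ₜ 1 : A ⊗[k] Aᵐᵒᵖ) • m)) (x : X) (m : M) : lift f hf (mk X M x m) = f x m :=
  rfl

/-- The functoriality of the tensor product with respect to additive maps that are compatible with
the right action on the first factor and the left action on the second one. -/
noncomputable def map (f : X →+ X') (g : M →+ M')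
    (hf : ∀ (a : A) x, f ((1 ⊗ₜ op a : A ⊗[k] Aᵐᵒᵖ) • x) = (1 ⊗ₜ op a : A ⊗[k] Aᵐᵒᵖ) • f x)
    (hg : ∀ (a : A) m, g ((a ⊗ₜ 1 : A ⊗[k] Aᵐᵒᵖ) • m) = (a ⊗ₜ 1 : A ⊗[k] Aᵐᵒᵖ) • g m) :
    BimoduleTensor X M →+ BimoduleTensor X' M' :=
  lift (((mk X' M').comp f).compl₂ g) fun a x m => by
    simp [hf, hg, mk_smul]

@[simp]
theorem map_mk (f : X →+ X') (g : M →+ M')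
    (hf : ∀ (a : A) x, f ((1 ⊗ₜ op a : A ⊗[k] Aᵐᵒᵖ) • x) = (1 ⊗ₜ op a : A ⊗[k] Aᵐᵒᵖ) • f x)
    (hg : ∀ (a : A) m, g ((a ⊗ₜ 1 : A ⊗[k] Aᵐᵒᵖ) • m) = (a ⊗ₜ 1 : A ⊗[k] Aᵐᵒᵖ) • g m)
    (x : X) (m : M) : map f g hf hg (mk X M x m) = mk X' M' (f x) (g m) :=
  rfl

/-- The action of the enveloping algebra before dividing by the balancing relations. -/
noncomputable def preAction (X M : ModuleCat.{u} (A ⊗[k] Aᵐᵒᵖ)) :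
    A ⊗[k] Aᵐᵒᵖ →ₐ[k] Module.End k (X ⊗[k] M) :=
  Module.endTensorEndAlgHom.comp (Algebra.TensorProduct.map
    ((Algebra.lsmul k k X : A ⊗[k] Aᵐᵒᵖ →ₐ[k] Module.End k X).comp Algebra.TensorProduct.includeLeft)
    ((Algebra.lsmul k k M : A ⊗[k] Aᵐᵒᵖ →ₐ[k] Module.End k M).comp Algebra.TensorProduct.includeRight))

theorem preAction_tmul (a : A) (b : Aᵐᵒᵖ) (x : X) (m : M) :
    preAction X M (a ⊗ₜ b) (x ⊗ₜ m) =
      ((a ⊗ₜ 1 : A ⊗[k] Aᵐᵒᵖ) • x) ⊗ₜ ((1 ⊗ₜ b : A ⊗[k] Aᵐᵒᵖ) • m) :=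
  rfl

theorem balancing_le_comap_preAction (c : A ⊗[k] Aᵐᵒᵖ) :
    balancing X M ≤ (balancing X M).comap (preAction X M c).toAddMonoidHom := by
  refine (AddSubgroup.closure_le _).2 ?_
  rintro _ ⟨a, x, m, rfl⟩
  rw [SetLike.mem_coe, AddSubgroup.mem_comap]
  induction c with
  | zero => simp [zero_mem]
  | tmul b c =>
    refine AddSubgroup.subset_closure ⟨a, (b ⊗ₜ 1 : A ⊗[k] Aᵐᵒᵖ) • x,
      (1 ⊗ₜ c : A ⊗[k] Aᵐᵒᵖ) • m, ?_⟩
    simp [preAction_tmul, smul_smul]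
  | add c d hc hd =>
    rw [map_add]
    exact add_mem hc hd

/-- The action of the enveloping algebra on the tensor product of two bimodules. -/
noncomputable def action (X M : ModuleCat.{u} (A ⊗[k] Aᵐᵒᵖ)) :
    A ⊗[k] Aᵐᵒᵖ →+* AddMonoid.End (BimoduleTensor X M) where
  toFun c := QuotientAddGroup.map _ _ (preAction X M c).toAddMonoidHom
    (balancing_le_comap_preAction c)
  map_one' := hom_ext fun x m => congrArg (QuotientAddGroup.mk' (balancing X M))
    (congrArg (fun φ => φ (x ⊗ₜ m)) (map_one (preAction X M)))
  map_mul' c d := hom_ext fun x m => congrArg (QuotientAddGroup.mk' (balancing X M))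
    (congrArg (fun φ => φ (x ⊗ₜ m)) (map_mul (preAction X M) c d))
  map_zero' := hom_ext fun x m => congrArg (QuotientAddGroup.mk' (balancing X M))
    (congrArg (fun φ => φ (x ⊗ₜ m)) (map_zero (preAction X M)))
  map_add' c d := hom_ext fun x m => congrArg (QuotientAddGroup.mk' (balancing X M))
    (congrArg (fun φ => φ (x ⊗ₜ m)) (map_add (preAction X M) c d))

noncomputable instance : Module (A ⊗[k] Aᵐᵒᵖ) (BimoduleTensor X M) :=
  Module.compHom _ (action X M)

theorem tmul_smul_mk (a : A) (b : Aᵐᵒᵖ) (x : X) (m : M) :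
    (a ⊗ₜ b : A ⊗[k] Aᵐᵒᵖ) • mk X M x m =
      mk X M ((a ⊗ₜ 1 : A ⊗[k] Aᵐᵒᵖ) • x) ((1 ⊗ₜ b : A ⊗[k] Aᵐᵒᵖ) • m) :=
  rfl

theorem map_smul_of_tmul {V : Type*} [AddCommGroup V] [Module (A ⊗[k] Aᵐᵒᵖ) V]
    (φ : BimoduleTensor X M →+ V)
    (h : ∀ (a : A) (b : Aᵐᵒᵖ) x m, φ (mk X M ((a ⊗ₜ 1 : A ⊗[k] Aᵐᵒᵖ) • x)
      ((1 ⊗ₜ b : A ⊗[k] Aᵐᵒᵖ) • m)) = (a ⊗ₜ b : A ⊗[k] Aᵐᵒᵖ) • φ (mk X M x m))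
    (c : A ⊗[k] Aᵐᵒᵖ) (t : BimoduleTensor X M) : φ (c • t) = c • φ t := by
  induction c with
  | zero =>
    exact (congrArg φ (zero_smul (A ⊗[k] Aᵐᵒᵖ) t)).trans
      ((map_zero φ).trans (zero_smul (A ⊗[k] Aᵐᵒᵖ) (φ t)).symm)
  | add c d hc hd => rw [add_smul, map_add, hc, hd, add_smul]
  | tmul a b =>
    induction t using induction with
    | zero => simp
    | mk x m => rw [tmul_smul_mk, h]
    | add s t hs ht => rw [smul_add, map_add, map_add, hs, ht, smul_add]

/-- The tensor product of two morphisms of bimodules. -/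
noncomputable def mapHom (f : X ⟶ X') (g : M ⟶ M') :
    ModuleCat.of (A ⊗[k] Aᵐᵒᵖ) (BimoduleTensor X M) ⟶
      ModuleCat.of (A ⊗[k] Aᵐᵒᵖ) (BimoduleTensor X' M') :=
  ModuleCat.ofHom
    { map f.hom.toAddMonoidHom g.hom.toAddMonoidHom (by simp) (by simp) with
      map_smul' := map_smul_of_tmul _ fun a b x m => by
        change mk X' M' (f.hom ((a ⊗ₜ 1 : A ⊗[k] Aᵐᵒᵖ) • x))
          (g.hom ((1 ⊗ₜ b : A ⊗[k] Aᵐᵒᵖ) • m)) = _ • mk X' M' (f.hom x) (g.hom m)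
        rw [f.hom.map_smul, g.hom.map_smul, tmul_smul_mk] }

@[simp]
theorem mapHom_mk (f : X ⟶ X') (g : M ⟶ M') (x : X) (m : M) :
    (mapHom f g).hom (mk X M x m) = mk X' M' (f.hom x) (g.hom m) :=
  rfl

theorem moduleCat_hom_ext {V : ModuleCat.{u} (A ⊗[k] Aᵐᵒᵖ)}
    {f g : ModuleCat.of (A ⊗[k] Aᵐᵒᵖ) (BimoduleTensor X M) ⟶ V}
    (h : ∀ x m, f.hom (mk X M x m) = g.hom (mk X M x m)) : f = g := by
  ext t
  exact DFunLike.congr_fun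
    (hom_ext (f := f.hom.toAddMonoidHom) (g := g.hom.toAddMonoidHom) h) t

variable (k A) in
/-- The tensor product of bimodules over `A`, as a bifunctor. -/
noncomputable def bifunctor :
    ModuleCat.{u} (A ⊗[k] Aᵐᵒᵖ) ⥤ ModuleCat.{u} (A ⊗[k] Aᵐᵒᵖ) ⥤ ModuleCat.{u} (A ⊗[k] Aᵐᵒᵖ) where
  obj X :=
    { obj M := ModuleCat.of _ (BimoduleTensor X M)
      map g := mapHom (𝟙 X) g
      map_id _ := moduleCat_hom_ext fun _ _ => rfl
      map_comp _ _ := moduleCat_hom_ext fun _ _ => rfl }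
  map f :=
    { app _ := mapHom f (𝟙 _)
      naturality := fun _ _ _ => moduleCat_hom_ext fun _ _ => rfl }
  map_id _ := by ext : 2; exact moduleCat_hom_ext fun _ _ => rfl
  map_comp _ _ := by ext : 2; exact moduleCat_hom_ext fun _ _ => rfl

instance (X : ModuleCat.{u} (A ⊗[k] Aᵐᵒᵖ)) : ((bifunctor k A).obj X).Additive where
  map_add {_ N f g} := moduleCat_hom_ext fun x m => map_add (mk X N x) (f.hom m) (g.hom m)

/-- A bimodule is right projective if it is projective as a right module over `A`. -/
def RightProjective (X : ModuleCat.{u} (A ⊗[k] Aᵐᵒᵖ)) : Prop :=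
  Module.Projective Aᵐᵒᵖ ((ModuleCat.restrictScalars
    (Algebra.TensorProduct.includeRight : Aᵐᵒᵖ →ₐ[k] A ⊗[k] Aᵐᵒᵖ).toRingHom).obj X)

theorem RightProjective.exists_dualBasis (hX : RightProjective X) :
    ∃ s : X →+ (X →₀ Aᵐᵒᵖ),
      (∀ (b : Aᵐᵒᵖ) x y, s ((1 ⊗ₜ b : A ⊗[k] Aᵐᵒᵖ) • x) y = b * s x y) ∧
      ∀ x, (s x).sum (fun y b => (1 ⊗ₜ b : A ⊗[k] Aᵐᵒᵖ) • y) = x := by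
  obtain ⟨s, hs⟩ := Module.projective_def'.1 hX
  refine ⟨s.toAddMonoidHom, fun b x y => ?_, fun x => ?_⟩
  · exact DFunLike.congr_fun (s.map_smul b x) y
  · exact LinearMap.congr_fun hs x

/-- The coordinates of a tensor with respect to a dual basis of a right projective bimodule. -/
theorem RightProjective.exists_coordinates (hX : RightProjective X) :
    ∃ c : ∀ M : ModuleCat.{u} (A ⊗[k] Aᵐᵒᵖ), BimoduleTensor X M →+ (X →₀ M),
      (∀ M t, (c M t).sum (fun x m => mk X M x m) = t) ∧
      ∀ (M N : ModuleCat.{u} (A ⊗[k] Aᵐᵒᵖ)) (g : M ⟶ N) t x,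
        c N ((mapHom (𝟙 X) g).hom t) x = g.hom (c M t x) := by
  obtain ⟨s, hs, hs'⟩ := hX.exists_dualBasis
  let act (M : ModuleCat.{u} (A ⊗[k] Aᵐᵒᵖ)) : Aᵐᵒᵖ →+ M →+ M :=
    AddMonoidHom.mk' (fun b => DistribSMul.toAddMonoidHom M (b.unop ⊗ₜ 1 : A ⊗[k] Aᵐᵒᵖ))
      fun b b' => by ext m; exact (congrArg (fun c : A ⊗[k] Aᵐᵒᵖ => c • m)
        (add_tmul b.unop b'.unop 1)).trans (add_smul (R := A ⊗[k] Aᵐᵒᵖ) _ _ m)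
  let f (M : ModuleCat.{u} (A ⊗[k] Aᵐᵒᵖ)) : X →+ M →+ (X →₀ M) :=
    AddMonoidHom.mk' (fun x => AddMonoidHom.mk'
      (fun m => (s x).mapRange ((act M).flip m) (map_zero _)) fun m m' => by ext y; simp)
      fun x x' => by ext m y; simp
  have hf M x m y : f M x m y = ((s x y).unop ⊗ₜ 1 : A ⊗[k] Aᵐᵒᵖ) • m := rfl
  have hfs a M x m : f M ((1 ⊗ₜ op a : A ⊗[k] Aᵐᵒᵖ) • x) m =
      f M x ((a ⊗ₜ 1 : A ⊗[k] Aᵐᵒᵖ) • m) := by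
    ext y
    simp [hf, hs, smul_smul]
  let c M : BimoduleTensor X M →+ (X →₀ M) := lift (f M) fun a x m => hfs a M x m
  have hc M x m : c M (mk X M x m) = f M x m := rfl
  refine ⟨c, fun M t => ?_, fun M N g t x => ?_⟩
  · induction t using induction with
    | zero => simp
    | mk x m =>
      have h y b : mk X M y (act M b m) = mk X M ((1 ⊗ₜ b : A ⊗[k] Aᵐᵒᵖ) • y) m :=
        (mk_smul b.unop y m).symm
      rw [hc]
      change ((s x).mapRange ((act M).flip m) (map_zero _)).sum _ = _
      rw [Finsupp.sum_mapRange_index (by simp)]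
      conv_rhs => rw [← hs' x]
      simp [h, Finsupp.sum]
    | add s t hs ht =>
      rw [map_add, Finsupp.sum_add_index', hs, ht] <;> simp
  · induction t using induction with
    | zero => simp
    | mk x' m =>
      rw [mapHom_mk, hc, hc, hf, hf, ModuleCat.id_apply, map_smul]
    | add s t hs ht =>
      rw [map_add, map_add, Finsupp.add_apply, hs, ht, map_add, Finsupp.add_apply, map_add]

theorem mapHom_surjective {f : X ⟶ X'} {g : M ⟶ M'} (hf : Function.Surjective f.hom)
    (hg : Function.Surjective g.hom) : Function.Surjective (mapHom f g).hom := by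
  intro t
  induction t using induction with
  | zero => exact ⟨0, map_zero _⟩
  | mk x m =>
    obtain ⟨x, rfl⟩ := hf x
    obtain ⟨m, rfl⟩ := hg m
    exact ⟨mk X M x m, rfl⟩
  | add s t hs ht =>
    obtain ⟨s, rfl⟩ := hs
    obtain ⟨t, rfl⟩ := ht
    exact ⟨s + t, map_add _ _ _⟩

theorem RightProjective.shortExact_map (hX : RightProjective X)
    {S : ShortComplex (ModuleCat.{u} (A ⊗[k] Aᵐᵒᵖ))} (hS : S.ShortExact) :
    (S.map ((bifunctor k A).obj X)).ShortExact := by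
  obtain ⟨c, hc, hc'⟩ := hX.exists_coordinates
  have hfg := (ShortComplex.ShortExact.moduleCat_exact_iff_function_exact S).1 hS.exact
  refine ModuleCat.shortComplex_shortExact _ (fun t => ⟨fun h => ?_, ?_⟩)
    ((injective_iff_map_eq_zero (mapHom (𝟙 X) S.f).hom).2 fun t h => ?_)
    (mapHom_surjective Function.surjective_id hS.moduleCat_surjective_g)
  · change (mapHom (𝟙 X) S.g).hom t = 0 at h
    change t ∈ (mapHom (𝟙 X) S.f).hom.toAddMonoidHom.range
    rw [← hc _ t]
    refine sum_mem fun x _ => ?_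
    obtain ⟨m, hm⟩ := (hfg (c _ t x)).1 ((hc' _ _ S.g t x).symm.trans (by simp [h]))
    exact ⟨mk X S.X₁ x m, congrArg (mk X S.X₂ x) hm⟩
  · rintro ⟨t, rfl⟩
    exact DFunLike.congr_fun (congrArg ModuleCat.Hom.hom
      (S.map ((bifunctor k A).obj X)).zero) t
  · rw [← hc _ t]
    refine Finset.sum_eq_zero fun x _ => ?_
    have : c _ t x = 0 := hS.moduleCat_injective_f
      ((hc' _ _ S.f t x).symm.trans (by simp [h]))
    dsimp only
    rw [this, map_zero]

theorem RightProjective.preservesFiniteLimits_and_colimits (hX : RightProjective X) :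
    Limits.PreservesFiniteLimits ((bifunctor k A).obj X) ∧
      Limits.PreservesFiniteColimits ((bifunctor k A).obj X) :=
  ((Functor.exact_tfae ((bifunctor k A).obj X)).out 0 3 rfl rfl).1 fun _ => hX.shortExact_map

/-- A short exact sequence of bimodules with right projective last term splits as a sequence of
right modules. -/
theorem exists_rightSplitting {S : ShortComplex (ModuleCat.{u} (A ⊗[k] Aᵐᵒᵖ))}
    (hS : S.ShortExact) (h : RightProjective S.X₃) :
    ∃ (r : S.X₂ →+ S.X₁) (t : S.X₃ →+ S.X₂),
      (∀ (b : Aᵐᵒᵖ) x, r ((1 ⊗ₜ b : A ⊗[k] Aᵐᵒᵖ) • x) = (1 ⊗ₜ b : A ⊗[k] Aᵐᵒᵖ) • r x) ∧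
      (∀ (b : Aᵐᵒᵖ) x, t ((1 ⊗ₜ b : A ⊗[k] Aᵐᵒᵖ) • x) = (1 ⊗ₜ b : A ⊗[k] Aᵐᵒᵖ) • t x) ∧
      (∀ x, r (S.f.hom x) = x) ∧ ∀ x, S.f.hom (r x) + t (S.g.hom x) = x := by
  have hfg := (ShortComplex.ShortExact.moduleCat_exact_iff_function_exact S).1 hS.exact
  have hf : Function.Injective S.f.hom := hS.moduleCat_injective_f
  let ρ : Aᵐᵒᵖ →+* A ⊗[k] Aᵐᵒᵖ :=
    (Algebra.TensorProduct.includeRight : Aᵐᵒᵖ →ₐ[k] A ⊗[k] Aᵐᵒᵖ).toRingHom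
  have : Module.Projective Aᵐᵒᵖ ((ModuleCat.restrictScalars ρ).obj S.X₃) := h
  obtain ⟨t, ht⟩ := Module.projective_lifting_property ((ModuleCat.restrictScalars ρ).map S.g).hom
    LinearMap.id hS.moduleCat_surjective_g
  obtain ⟨t, ht, htb⟩ : ∃ t : S.X₃ →+ S.X₂, (∀ x, S.g.hom (t x) = x) ∧
      ∀ (b : Aᵐᵒᵖ) x, t ((1 ⊗ₜ b : A ⊗[k] Aᵐᵒᵖ) • x) = (1 ⊗ₜ b : A ⊗[k] Aᵐᵒᵖ) • t x :=
    ⟨t.toAddMonoidHom, LinearMap.congr_fun ht, t.map_smul⟩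
  have hr (x : S.X₂) : ∃ y, S.f.hom y = x - t (S.g.hom x) :=
    (hfg _).1 (by
      change S.g.hom _ = 0
      rw [map_sub, ht, sub_self])
  choose r hr using hr
  refine ⟨AddMonoidHom.mk' r fun x y => hf ?_, t, fun b x => hf ?_, htb,
    fun x => hf ?_, fun x => ?_⟩
  · rw [map_add, hr, hr, hr, map_add, map_add]
    abel
  · change S.f.hom (r _) = S.f.hom (_ • r x)
    rw [map_smul, hr, hr, map_smul, htb, smul_sub]
  · have h0 : S.g.hom (S.f.hom x) = 0 := (hfg _).2 ⟨x, rfl⟩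
    rw [AddMonoidHom.mk'_apply, hr, h0, map_zero, sub_zero]
  · rw [AddMonoidHom.mk'_apply, hr, sub_add_cancel]

theorem RightProjective.of_shortExact {S : ShortComplex (ModuleCat.{u} (A ⊗[k] Aᵐᵒᵖ))}
    (hS : S.ShortExact) (h₂ : RightProjective S.X₂) (h₃ : RightProjective S.X₃) :
    RightProjective S.X₁ := by
  obtain ⟨r, t, hr, -, hrf, -⟩ := exists_rightSplitting hS h₃
  let ρ : Aᵐᵒᵖ →+* A ⊗[k] Aᵐᵒᵖ :=
    (Algebra.TensorProduct.includeRight : Aᵐᵒᵖ →ₐ[k] A ⊗[k] Aᵐᵒᵖ).toRingHom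
  let r' : (ModuleCat.restrictScalars ρ).obj S.X₂ →ₗ[Aᵐᵒᵖ] (ModuleCat.restrictScalars ρ).obj S.X₁ :=
    { toFun := r
      map_add' := r.map_add
      map_smul' := hr }
  have : Module.Projective Aᵐᵒᵖ ((ModuleCat.restrictScalars ρ).obj S.X₂) := h₂
  exact Module.Projective.of_split ((ModuleCat.restrictScalars ρ).map S.f).hom r'
    (LinearMap.ext hrf)

theorem RightProjective.shortExact_app {X₁ X₂ X₃ : ModuleCat.{u} (A ⊗[k] Aᵐᵒᵖ)}
    (i : X₁ ⟶ X₂) (π : X₂ ⟶ X₃) (z : i ≫ π = 0) (h : (ShortComplex.mk i π z).ShortExact)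
    (h₃ : RightProjective X₃) (M : ModuleCat.{u} (A ⊗[k] Aᵐᵒᵖ)) :
    ∃ z' : ((bifunctor k A).map i).app M ≫ ((bifunctor k A).map π).app M = 0,
      (ShortComplex.mk _ _ z').ShortExact := by
  obtain ⟨r, t, hr, ht, hri, hrt⟩ := exists_rightSplitting h h₃
  dsimp only at r t hr ht hri hrt
  let r' : BimoduleTensor X₂ M →+ BimoduleTensor X₁ M :=
    map r (.id M) (fun a => hr (op a)) fun _ _ => rfl
  let t' : BimoduleTensor X₃ M →+ BimoduleTensor X₂ M :=
    map t (.id M) (fun a => ht (op a)) fun _ _ => rfl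
  have hri' (y) : r' ((mapHom i (𝟙 M)).hom y) = y :=
    DFunLike.congr_fun (hom_ext (f := r'.comp (mapHom i (𝟙 M)).hom.toAddMonoidHom)
      (g := .id _) fun x m => congrArg (mk X₁ M · m) (hri x)) y
  have hrt' (y) : (mapHom i (𝟙 M)).hom (r' y) + t' ((mapHom π (𝟙 M)).hom y) = y :=
    DFunLike.congr_fun (hom_ext (f := (mapHom i (𝟙 M)).hom.toAddMonoidHom.comp r' +
      t'.comp (mapHom π (𝟙 M)).hom.toAddMonoidHom) (g := .id _) fun x m => by
        refine Eq.trans ?_ (congrArg (mk X₂ M · m) (hrt x))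
        exact (DFunLike.congr_fun ((mk X₂ M).map_add _ _) m).symm) y
  have z' : mapHom i (𝟙 M) ≫ mapHom π (𝟙 M) = 0 := moduleCat_hom_ext fun x m => by
    have : π.hom (i.hom x) = 0 := LinearMap.congr_fun (congrArg ModuleCat.Hom.hom z) x
    change mk X₃ M (π.hom (i.hom x)) m = 0
    rw [this, map_zero, AddMonoidHom.zero_apply]
  refine ⟨z', ModuleCat.shortComplex_shortExact _ (fun y => ⟨fun hy => ?_, ?_⟩)
    (Function.LeftInverse.injective hri')
    (mapHom_surjective h.moduleCat_surjective_g Function.surjective_id)⟩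
  · refine ⟨r' y, ?_⟩
    have := hrt' y
    change (mapHom π (𝟙 M)).hom y = 0 at hy
    rwa [hy, map_zero, add_zero] at this
  · rintro ⟨y, rfl⟩
    exact LinearMap.congr_fun (congrArg ModuleCat.Hom.hom z') y

theorem RightProjective.of_projective (X : ModuleCat.{u} (A ⊗[k] Aᵐᵒᵖ)) (hX : Projective X) :
    RightProjective X := by
  have : Module.Projective (A ⊗[k] Aᵐᵒᵖ) X := (IsProjective.iff_projective X).2 hX
  let ρ : Aᵐᵒᵖ →+* A ⊗[k] Aᵐᵒᵖ :=
    (Algebra.TensorProduct.includeRight : Aᵐᵒᵖ →ₐ[k] A ⊗[k] Aᵐᵒᵖ).toRingHom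
  let e : Aᵐᵒᵖ ⊗[k] A ≃+ A ⊗[k] Aᵐᵒᵖ := (TensorProduct.comm k Aᵐᵒᵖ A).toAddEquiv
  have he (b : Aᵐᵒᵖ) (x : Aᵐᵒᵖ ⊗[k] A) : e (b • x) = (1 ⊗ₜ b : A ⊗[k] Aᵐᵒᵖ) * e x := by
    induction x with
    | zero => simp
    | tmul b' a =>
      change a ⊗ₜ (b * b') = (1 ⊗ₜ b : A ⊗[k] Aᵐᵒᵖ) * (a ⊗ₜ b')
      simp
    | add x y hx hy => rw [smul_add, map_add, map_add, hx, hy, mul_add]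
  let e' : Aᵐᵒᵖ ⊗[k] A ≃ₗ[Aᵐᵒᵖ]
      (ModuleCat.restrictScalars ρ).obj (ModuleCat.of _ (A ⊗[k] Aᵐᵒᵖ)) :=
    { e with map_smul' := he }
  exact Module.Projective.restrictScalars ρ (Module.Projective.of_equiv e') X

variable (k A) in
/-- The algebra `A` as a bimodule over itself. -/
noncomputable def regular : ModuleCat.{u} (A ⊗[k] Aᵐᵒᵖ) :=
  letI : Module (A ⊗[k] Aᵐᵒᵖ) A := TensorProduct.Algebra.module
  ModuleCat.of (A ⊗[k] Aᵐᵒᵖ) A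

variable (k A) in
/-- The identity of `A`, as a map to the regular bimodule. -/
noncomputable def toRegular : A ≃+ regular k A :=
  AddEquiv.refl A

@[simp]
theorem tmul_smul_toRegular (a : A) (b : Aᵐᵒᵖ) (x : A) :
    (a ⊗ₜ b : A ⊗[k] Aᵐᵒᵖ) • toRegular k A x = toRegular k A (a * x * b.unop) :=
  (TensorProduct.Algebra.smul_def a b x).trans (mul_assoc a x b.unop).symm

theorem rightProjective_regular : RightProjective (regular k A) := by
  let ρ : Aᵐᵒᵖ →+* A ⊗[k] Aᵐᵒᵖ :=
    (Algebra.TensorProduct.includeRight : Aᵐᵒᵖ →ₐ[k] A ⊗[k] Aᵐᵒᵖ).toRingHom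
  let e : Aᵐᵒᵖ ≃+ regular k A := opAddEquiv.symm.trans (toRegular k A)
  have he (b x : Aᵐᵒᵖ) : e (b * x) = (1 ⊗ₜ b : A ⊗[k] Aᵐᵒᵖ) • e x := by simp [e]
  let e' : Aᵐᵒᵖ ≃ₗ[Aᵐᵒᵖ] (ModuleCat.restrictScalars ρ).obj (regular k A) :=
    { e with map_smul' := he }
  exact Module.Projective.of_equiv e'

variable (M) in
/-- The left action of `A` on a bimodule. -/
noncomputable def leftAction : A →+ M →+ M :=
  AddMonoidHom.mk' (fun a => DistribSMul.toAddMonoidHom M (a ⊗ₜ 1 : A ⊗[k] Aᵐᵒᵖ)) fun a b => by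
    ext m
    exact (congrArg (fun c : A ⊗[k] Aᵐᵒᵖ => c • m) (add_tmul a b 1)).trans
      (add_smul (R := A ⊗[k] Aᵐᵒᵖ) _ _ m)

variable (X) in
/-- The right action of `A` on a bimodule. -/
noncomputable def rightAction : A →+ X →+ X :=
  AddMonoidHom.mk' (fun a => DistribSMul.toAddMonoidHom X (1 ⊗ₜ op a : A ⊗[k] Aᵐᵒᵖ)) fun a b => by
    ext x
    exact (congrArg (fun c : A ⊗[k] Aᵐᵒᵖ => c • x) (tmul_add 1 (op a) (op b))).trans
      (add_smul (R := A ⊗[k] Aᵐᵒᵖ) _ _ x)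

@[simp]
theorem leftAction_apply (a : A) (m : M) : leftAction M a m = (a ⊗ₜ 1 : A ⊗[k] Aᵐᵒᵖ) • m :=
  rfl

@[simp]
theorem rightAction_apply (x : X) (a : A) :
    rightAction X a x = (1 ⊗ₜ op a : A ⊗[k] Aᵐᵒᵖ) • x :=
  rfl

variable (M) in
/-- The left unitor `A ⊗_A M ⟶ M`. -/
noncomputable def left : (((bifunctor k A).obj (regular k A)).obj M) ⟶ M :=
  ModuleCat.ofHom
    { lift ((leftAction M).comp (toRegular k A).symm.toAddMonoidHom) (fun a x m => by
        obtain ⟨x, rfl⟩ := (toRegular k A).surjective x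
        simp [smul_smul]) with
      map_smul' := map_smul_of_tmul _ fun a b x m => by
        obtain ⟨x, rfl⟩ := (toRegular k A).surjective x
        simp [smul_smul] }

variable (X) in
/-- The right unitor `X ⊗_A A ⟶ X`. -/
noncomputable def right : (((bifunctor k A).obj X).obj (regular k A)) ⟶ X :=
  ModuleCat.ofHom
    { lift ((rightAction X).comp (toRegular k A).symm.toAddMonoidHom).flip (fun a x m => by
        obtain ⟨m, rfl⟩ := (toRegular k A).surjective m
        simp [smul_smul]) with
      map_smul' := map_smul_of_tmul _ fun a b x m => by
        obtain ⟨m, rfl⟩ := (toRegular k A).surjective m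
        simp [smul_smul] }

theorem left_mk (a : A) (m : M) :
    (left M).hom (mk (regular k A) M (toRegular k A a) m) = (a ⊗ₜ 1 : A ⊗[k] Aᵐᵒᵖ) • m :=
  rfl

theorem right_mk (x : X) (a : A) :
    (right X).hom (mk X (regular k A) x (toRegular k A a)) = (1 ⊗ₜ op a : A ⊗[k] Aᵐᵒᵖ) • x :=
  rfl

theorem left_naturality {N : ModuleCat.{u} (A ⊗[k] Aᵐᵒᵖ)} (φ : M ⟶ N) :
    ((bifunctor k A).obj (regular k A)).map φ ≫ left N = left M ≫ φ :=
  moduleCat_hom_ext fun _ m => (φ.hom.map_smul _ m).symm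

theorem right_naturality (φ : X ⟶ X') :
    ((bifunctor k A).map φ).app (regular k A) ≫ right X' = right X ≫ φ :=
  moduleCat_hom_ext fun x _ => (φ.hom.map_smul _ x).symm

theorem left_regular : left (regular k A) = right (regular k A) :=
  moduleCat_hom_ext fun x y => by
    obtain ⟨x, rfl⟩ := (toRegular k A).surjective x
    obtain ⟨y, rfl⟩ := (toRegular k A).surjective y
    exact (left_mk x _).trans (Eq.trans (by simp) (right_mk _ y).symm)

theorem isIso_left_regular : IsIso (left (regular k A)) := by
  refine (ConcreteCategory.isIso_iff_bijective _).2
    (Function.bijective_iff_has_inverse.2 ⟨mk _ _ (toRegular k A 1), fun t => ?_, fun a => ?_⟩)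
  · refine DFunLike.congr_fun (hom_ext (f := (mk _ _ (toRegular k A 1)).comp
      (left (regular k A)).hom.toAddMonoidHom) (g := .id _) fun x m => ?_) t
    obtain ⟨x, rfl⟩ := (toRegular k A).surjective x
    change mk _ _ (toRegular k A 1) ((x ⊗ₜ 1 : A ⊗[k] Aᵐᵒᵖ) • m) = mk _ _ (toRegular k A x) m
    rw [← mk_smul, tmul_smul_toRegular]
    simp
  · exact (left_mk 1 a).trans (one_smul (A ⊗[k] Aᵐᵒᵖ) a)

variable (k A) in
/-- The tensor product of bimodules over `A`, with the regular bimodule as unit and the right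
projective bimodules as flat objects. -/
noncomputable def unitalBifunctor : UnitalBifunctor (ModuleCat.{u} (A ⊗[k] Aᵐᵒᵖ)) where
  tensor := bifunctor k A
  unit := regular k A
  flat := RightProjective
  additive _ := inferInstance
  flat_of_projective := RightProjective.of_projective
  flat_unit := rightProjective_regular
  flat_left := RightProjective.of_shortExact
  preservesFiniteLimits h := h.preservesFiniteLimits_and_colimits.1
  preservesFiniteColimits h := h.preservesFiniteLimits_and_colimits.2
  shortExact_app i π z h h₃ M := h₃.shortExact_app i π z h M
  left := left
  right := right
  left_naturality := left_naturality
  right_naturality := right_naturality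
  left_unit := left_regular
  isIso_left_unit := isIso_left_regular

end BimoduleTensor

end

/-- Hochschild cohomology is graded-commutative: for a field `k` and an associative `k`-algebra
`A`, regarded as a module over its enveloping algebra `A^e = A ⊗[k] Aᵐᵒᵖ` (i.e. as an
`A`-bimodule via left and right multiplication), the Hochschild cohomology algebra
`HH^*(A) = Ext^*_{A^e}(A, A)` is graded-commutative for the Yoneda product: for
`f ∈ Ext^p_{A^e}(A, A)` and `g ∈ Ext^q_{A^e}(A, A)`, one has `g ∘ f = (-1)^{pq} f ∘ g`
(where `f.comp g` is the Yoneda composite `g ∘ f`). -/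
theorem hochschild_cohomology_graded_comm (k : Type u) [Field k]
    (A : Type u) [Ring A] [Algebra k A] (p q : ℕ) :
    letI : Module (A ⊗[k] Aᵐᵒᵖ) A := TensorProduct.Algebra.module
    letI : HasDerivedCategory (ModuleCat (A ⊗[k] Aᵐᵒᵖ)) := HasDerivedCategory.standard _
    letI : HasExt (ModuleCat (A ⊗[k] Aᵐᵒᵖ)) := hasExt_of_hasDerivedCategory _
    ∀ (f : Ext (ModuleCat.of (A ⊗[k] Aᵐᵒᵖ) A) (ModuleCat.of (A ⊗[k] Aᵐᵒᵖ) A) p)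
      (g : Ext (ModuleCat.of (A ⊗[k] Aᵐᵒᵖ) A) (ModuleCat.of (A ⊗[k] Aᵐᵒᵖ) A) q),
      f.comp g rfl = ((-1 : ℤ) ^ (p * q)) • g.comp f (by omega) := by
  let _ : HasDerivedCategory (ModuleCat (A ⊗[k] Aᵐᵒᵖ)) := HasDerivedCategory.standard _
  let _ : HasExt (ModuleCat (A ⊗[k] Aᵐᵒᵖ)) := hasExt_of_hasDerivedCategory _
  exact (BimoduleTensor.unitalBifunctor k A).comp_eq_neg_one_pow_smul_comp
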